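/- Let d ≥ 2, α ∈ (0,2), β ∈ (0, α/2), and D = B(0,1) ⊂ ℝ^d the open Euclidean unit ball. For a continuous φ : closure(D) → ℝ, x ∈ ∂D and ε > 0, set ℋ_{β,ε}φ(x) = ∫_{{ y ∈ ℝ^d : (y−x)·x < 0, |y−x| ≥ ε }} [ φ(Λ(x,y)) − φ(x) ] |y−x|^{−d−β} dy, and say that φ ∈ H_β if lim_{ε→0} sup_{x ∈ ∂D} |ℋ_{β,ε}φ(x)| = 0. Then for every pair of functions φ₁, φ₂ : closure(D) → ℝ that are nonnegative, not identically zero, radially symmetric (φ_j(x) depends only on |x|), Hölder continuous of exponent α/2 on closure(D), and vanish identically on ∂D, there exists a > 0 such that φ₁ − a φ₂ ∈ H_β. -/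

import Mathlib

open MeasureTheory Metric Set
open scoped RealInnerProductSpace

noncomputable section

/-- `lamT D y z` is the largest `t ∈ [0,1]` such that `y + t • (z - y) ∈ closure D`. -/
def lamT {d : ℕ} (D : Set (EuclideanSpace ℝ (Fin d)))
    (y z : EuclideanSpace ℝ (Fin d)) : ℝ :=
  sSup {t : ℝ | t ∈ Set.Icc (0 : ℝ) 1 ∧ y + t • (z - y) ∈ closure D}

/-- The cutoff map `Λ`. -/
def Lam {d : ℕ} (D : Set (EuclideanSpace ℝ (Fin d)))
    (y z : EuclideanSpace ℝ (Fin d)) : EuclideanSpace ℝ (Fin d) :=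
  y + lamT D y z • (z - y)

/-- For `D = B(0,1)`, `x ∈ ∂D` and `ε > 0`, the truncated boundary operator
`ℋ_{β,ε}φ(x) = ∫_{(y−x)·x<0, |y−x|≥ε} [φ(Λ(x,y)) − φ(x)] |y−x|^{−d−β} dy`. -/
def Hbe (d : ℕ) (β ε : ℝ) (φ : EuclideanSpace ℝ (Fin d) → ℝ)
    (x : EuclideanSpace ℝ (Fin d)) : ℝ :=
  ∫ y in {y : EuclideanSpace ℝ (Fin d) | ⟪y - x, x⟫ < 0 ∧ ε ≤ ‖y - x‖},
    (φ (Lam (Metric.ball (0 : EuclideanSpace ℝ (Fin d)) 1) x y) - φ x)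
      * ‖y - x‖ ^ (-(d : ℝ) - β)

/-- `φ ∈ H_β` iff `lim_{ε→0} sup_{x ∈ ∂B(0,1)} |ℋ_{β,ε}φ(x)| = 0`. -/
def memHbeta (d : ℕ) (β : ℝ) (φ : EuclideanSpace ℝ (Fin d) → ℝ) : Prop :=
  ∀ δ : ℝ, 0 < δ → ∃ ε₀ : ℝ, 0 < ε₀ ∧ ∀ ε : ℝ, 0 < ε → ε < ε₀ →
    ∀ x ∈ Metric.sphere (0 : EuclideanSpace ℝ (Fin d)) 1, |Hbe d β ε φ x| ≤ δ

abbrev EE (d : ℕ) := EuclideanSpace ℝ (Fin d)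

def RR {d : ℕ} (ε : ℝ) (x : EE d) : Set (EE d) :=
  {y | ⟪y - x, x⟫ < 0 ∧ ε ≤ ‖y - x‖ ∧ ‖y‖ ≤ 1}

def GG {d : ℕ} (β ε : ℝ) (φ : EE d → ℝ) (x : EE d) : EE d → ℝ :=
  (RR ε x).indicator (fun y => φ y * ‖y - x‖ ^ (-(d : ℝ) - β))

lemma RR_meas {d : ℕ} (ε : ℝ) (x : EE d) : MeasurableSet (RR ε x) := by
  have h1 : MeasurableSet {y : EE d | ⟪y - x, x⟫ < 0} :=
    (isOpen_lt (by fun_prop) (by fun_prop)).measurableSet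
  have h2 : MeasurableSet {y : EE d | ε ≤ ‖y - x‖} :=
    (isClosed_le (by fun_prop) (by fun_prop)).measurableSet
  have h3 : MeasurableSet {y : EE d | ‖y‖ ≤ 1} :=
    (isClosed_le (by fun_prop) (by fun_prop)).measurableSet
  exact h1.inter (h2.inter h3)

lemma clB {d : ℕ} : closure (Metric.ball (0 : EE d) 1) = Metric.closedBall 0 1 :=
  closure_ball _ one_ne_zero

lemma Lam_in {d : ℕ} (x y : EE d) (hy : ‖y‖ ≤ 1) :
    Lam (Metric.ball (0 : EE d) 1) x y = y := by
  have : lamT (Metric.ball (0 : EE d) 1) x y = 1 := by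
    unfold lamT
    apply IsGreatest.csSup_eq
    refine ⟨⟨by simp, ?_⟩, fun t ht => ht.1.2⟩
    rw [clB]; simpa using hy
  simp [Lam, this]

lemma Lam_out {d : ℕ} (x y : EE d) (hx : ‖x‖ = 1) (hy : 1 < ‖y‖) :
    ‖Lam (Metric.ball (0 : EE d) 1) x y‖ = 1 := by
  set S : Set ℝ := {t : ℝ | t ∈ Set.Icc (0 : ℝ) 1 ∧ x + t • (y - x) ∈ closure (Metric.ball (0 : EE d) 1)} with hS
  have hSe : S = Set.Icc (0 : ℝ) 1 ∩ {t | ‖x + t • (y - x)‖ ≤ 1} := by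
    rw [hS, clB]; ext t; simp
  have hc : Continuous (fun t : ℝ => ‖x + t • (y - x)‖) := by fun_prop
  have hcomp : IsCompact S := by
    rw [hSe]; exact isCompact_Icc.inter_right (isClosed_le hc continuous_const)
  have hne : S.Nonempty := ⟨0, by rw [hSe]; simp [hx]⟩
  have hm : sSup S ∈ S := hcomp.sSup_mem hne
  have hL : Lam (Metric.ball (0 : EE d) 1) x y = x + sSup S • (y - x) := rfl
  rw [hL]
  have hm : sSup S ∈ Set.Icc (0 : ℝ) 1 ∩ {t | ‖x + t • (y - x)‖ ≤ 1} := hSe ▸ hm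
  refine le_antisymm hm.2 ?_
  by_contra hlt
  push Not at hlt
  have h1 : sSup S < 1 := by
    refine lt_of_le_of_ne hm.1.2 ?_
    intro h
    rw [h] at hlt
    simp at hlt
    linarith
  have hev : ∀ᶠ t in nhds (sSup S), ‖x + t • (y - x)‖ < 1 :=
    (hc.tendsto (sSup S)).eventually_lt_const hlt
  have hev2 : ∀ᶠ t in nhds (sSup S), t < 1 := eventually_lt_nhds h1
  have hev3 : ∀ᶠ t in nhdsWithin (sSup S) (Set.Ioi (sSup S)), sSup S < t := self_mem_nhdsWithin
  obtain ⟨t, ⟨ht, ht1⟩, htg⟩ :=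
    (((hev.and hev2).filter_mono nhdsWithin_le_nhds).and hev3).exists
  have h0 : 0 ≤ sSup S := hm.1.1
  have htS : t ∈ S := by
    rw [hSe]; exact ⟨⟨h0.trans (le_of_lt htg), ht1.le⟩, ht.le⟩
  exact absurd (le_csSup hcomp.bddAbove htS) (not_le.2 htg)

lemma Hbe_eq {d : ℕ} (β ε : ℝ) (φ : EE d → ℝ) (x : EE d) (hx : ‖x‖ = 1)
    (hbd : ∀ x ∈ Metric.sphere (0 : EE d) 1, φ x = 0) :
    Hbe d β ε φ x = ∫ y, GG β ε φ x y := by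
  have hm : MeasurableSet {y : EE d | ⟪y - x, x⟫ < 0 ∧ ε ≤ ‖y - x‖} := by
    have h1 : MeasurableSet {y : EE d | ⟪y - x, x⟫ < 0} :=
      (isOpen_lt (by fun_prop) (by fun_prop)).measurableSet
    have h2 : MeasurableSet {y : EE d | ε ≤ ‖y - x‖} :=
      (isClosed_le (by fun_prop) (by fun_prop)).measurableSet
    exact h1.inter h2
  unfold Hbe
  rw [← integral_indicator hm]
  congr 1
  ext y
  have hx0 : φ x = 0 := hbd x (by simpa using hx)
  by_cases h : ⟪y - x, x⟫ < 0 ∧ ε ≤ ‖y - x‖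
  · rw [Set.indicator_of_mem (by exact h)]
    by_cases hy : ‖y‖ ≤ 1
    · rw [Lam_in x y hy, GG, Set.indicator_of_mem (show y ∈ RR ε x from ⟨h.1, h.2, hy⟩), hx0, sub_zero]
    · rw [GG, Set.indicator_of_notMem (show y ∉ RR ε x from fun h => hy h.2.2), hx0,
        hbd _ (by simpa using Lam_out x y hx (not_le.1 hy))]
      simp
  · rw [Set.indicator_of_notMem (by exact h), GG,
      Set.indicator_of_notMem (show y ∉ RR ε x from fun h' => h ⟨h'.1, h'.2.1⟩)]

lemma GG_rot {d : ℕ} (β ε : ℝ) (φ : EE d → ℝ) (x x' : EE d) (hx : ‖x‖ = 1) (hx' : ‖x'‖ = 1)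
    (hrad : ∀ u ∈ closure (Metric.ball (0 : EE d) 1),
      ∀ v ∈ closure (Metric.ball (0 : EE d) 1), ‖u‖ = ‖v‖ → φ u = φ v) :
    ∫ y, GG β ε φ x y = ∫ y, GG β ε φ x' y := by
  obtain ⟨R, hR⟩ : ∃ R : EE d ≃ₗᵢ[ℝ] EE d, R x = x' :=
    ⟨_, Submodule.reflection_sub (hx.trans hx'.symm)⟩
  rw [← (LinearIsometryEquiv.measurePreserving R).integral_comp
    R.toHomeomorph.measurableEmbedding (GG β ε φ x')]
  congr 1
  ext y
  have hn : ‖R y - x'‖ = ‖y - x‖ := by rw [← hR, ← map_sub, R.norm_map]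
  have hi : (⟪R y - x', x'⟫ : ℝ) = ⟪y - x, x⟫ := by
    rw [← hR, ← map_sub, R.inner_map_map]
  have hmem : R y ∈ RR ε x' ↔ y ∈ RR ε x := by
    simp only [RR, Set.mem_setOf_eq, hn, hi, R.norm_map]
  by_cases h : y ∈ RR ε x
  · rw [GG, GG, Set.indicator_of_mem h, Set.indicator_of_mem (hmem.2 h), hn,
      hrad (R y) (by rw [clB]; simpa using h.2.2) y (by rw [clB]; simpa using h.2.2) (R.norm_map y)]
  · rw [GG, GG, Set.indicator_of_notMem h, Set.indicator_of_notMem (fun h' => h (hmem.1 h'))]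

lemma hol_cont {d : ℕ} (γ K : ℝ) (hγ : 0 < γ) (φ : EE d → ℝ)
    (hol : ∀ u ∈ closure (Metric.ball (0 : EE d) 1),
      ∀ v ∈ closure (Metric.ball (0 : EE d) 1), |φ u - φ v| ≤ K * ‖u - v‖ ^ γ) :
    ContinuousOn φ (Metric.closedBall 0 1) := by
  rw [clB] at hol
  intro u hu
  have h1 : Filter.Tendsto (fun v => K * ‖v - u‖ ^ γ) (nhdsWithin u (Metric.closedBall 0 1)) (nhds 0) := by
    have : Continuous (fun v : EE d => K * ‖v - u‖ ^ γ) := by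
      refine continuous_const.mul (Continuous.rpow_const (by fun_prop) (fun _ => Or.inr hγ.le))
    have := this.tendsto u
    simp [Real.zero_rpow hγ.ne'] at this
    exact this.mono_left nhdsWithin_le_nhds
  rw [ContinuousWithinAt, tendsto_iff_dist_tendsto_zero]
  refine squeeze_zero' (Filter.Eventually.of_forall fun _ => dist_nonneg) ?_ h1
  filter_upwards [self_mem_nhdsWithin] with v hv
  exact hol v hv u hu

lemma GG_aesm {d : ℕ} (β ε : ℝ) (φ : EE d → ℝ) (x : EE d)
    (hc : ContinuousOn φ (Metric.closedBall 0 1)) :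
    AEStronglyMeasurable (GG β ε φ x) := by
  unfold GG
  rw [aestronglyMeasurable_indicator_iff (RR_meas ε x)]
  refine AEStronglyMeasurable.mul ?_ ?_
  · exact (hc.mono (fun y hy => by simpa using hy.2.2)).aestronglyMeasurable (RR_meas ε x)
  · have : Measurable (fun y : EE d => ‖y - x‖ ^ (-(d : ℝ) - β)) := by fun_prop
    exact this.aestronglyMeasurable

lemma bound_int {d : ℕ} (hd : 2 ≤ d) (q : ℝ) (hq : -(d : ℝ) < q) (x : EE d) :
    Integrable (fun y : EE d => (Set.Iio (3 : ℝ)).indicator (fun t => t ^ q) ‖y - x‖) := by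
  haveI : Nontrivial (EE d) := by
    haveI : Nonempty (Fin d) := ⟨⟨0, by omega⟩⟩
    infer_instance
  have h := (integrable_fun_norm_addHaar (volume : Measure (EE d))
    (f := (Set.Iio (3 : ℝ)).indicator (fun t => t ^ q))).2 ?_
  · exact h.comp_sub_right x
  · have h1 : IntegrableOn (fun t : ℝ => t ^ ((d : ℝ) - 1 + q)) (Set.Ioo 0 3) :=
      (intervalIntegral.integrableOn_Ioo_rpow_iff (by norm_num)).2 (by linarith)
    rw [← integrable_indicator_iff measurableSet_Ioo] at h1
    rw [← integrable_indicator_iff measurableSet_Ioi]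
    refine h1.congr (Filter.Eventually.of_forall fun t => ?_)
    simp only [Set.indicator, Set.mem_Ioo, Set.mem_Ioi, Set.mem_Iio, finrank_euclideanSpace_fin]
    by_cases h0 : 0 < t
    · by_cases h3 : t < 3
      · simp only [h0, h3, and_self, if_true, smul_eq_mul]
        rw [Real.rpow_add h0, ← Real.rpow_natCast, Nat.cast_sub (by omega)]
        simp
      · simp [h3]
    · simp [h0]

lemma GG_le {d : ℕ} (β ε : ℝ) (hε : 0 ≤ ε) (φ : EE d → ℝ) (x y : EE d) :
    ‖GG β ε φ x y‖ ≤ ‖GG β 0 φ x y‖ := by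
  by_cases h : y ∈ RR ε x
  · rw [GG, GG, Set.indicator_of_mem h,
      Set.indicator_of_mem (show y ∈ RR 0 x from ⟨h.1, norm_nonneg _, h.2.2⟩)]
  · rw [GG, Set.indicator_of_notMem h]; simp

lemma GG_int {d : ℕ} (hd : 2 ≤ d) (β γ K : ℝ) (hγ : 0 < γ) (hβ : β < γ) (φ : EE d → ℝ)
    (x : EE d) (hx : ‖x‖ = 1)
    (hol : ∀ u ∈ closure (Metric.ball (0 : EE d) 1),
      ∀ v ∈ closure (Metric.ball (0 : EE d) 1), |φ u - φ v| ≤ K * ‖u - v‖ ^ γ)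
    (hbd : ∀ x ∈ Metric.sphere (0 : EE d) 1, φ x = 0) :
    Integrable (GG β 0 φ x) := by
  refine ((bound_int hd (γ + (-(d : ℝ) - β)) (by linarith) x).const_mul K).mono'
    (GG_aesm β 0 φ x (hol_cont γ K hγ φ hol)) (Filter.Eventually.of_forall fun y => ?_)
  by_cases h : y ∈ RR 0 x
  · have hne : y - x ≠ 0 := by
      intro h0
      have := h.1
      simp [h0] at this
    have hpos : 0 < ‖y - x‖ := norm_pos_iff.2 hne
    have h3 : ‖y - x‖ < 3 := by
      have := norm_sub_le y x
      have := h.2.2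
      linarith
    rw [GG, Set.indicator_of_mem h, Set.indicator_of_mem (show ‖y - x‖ ∈ Set.Iio 3 from h3),
      Real.rpow_add hpos, norm_mul, Real.norm_of_nonneg (Real.rpow_nonneg hpos.le _), ← mul_assoc]
    refine mul_le_mul_of_nonneg_right ?_ (Real.rpow_nonneg hpos.le _)
    have := hol y (by rw [clB]; simpa using h.2.2) x (by rw [clB]; simp [hx])
    rwa [hbd x (by simpa using hx), sub_zero] at this
  · have hK : 0 ≤ K := by
      have h1 := hol x (by rw [clB]; simp [hx]) (-x) (by rw [clB]; simp [hx])
      have h2 : 0 < ‖x - -x‖ ^ γ := by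
        apply Real.rpow_pos_of_pos
        rw [sub_neg_eq_add, ← two_smul ℝ x, norm_smul, hx]; norm_num
      exact nonneg_of_mul_nonneg_left ((abs_nonneg _).trans h1) h2
    rw [GG, Set.indicator_of_notMem h, norm_zero]
    refine mul_nonneg hK (Set.indicator_apply_nonneg fun _ => Real.rpow_nonneg (norm_nonneg _) _)

lemma GG_tendsto {d : ℕ} (β : ℝ) (φ : EE d → ℝ) (x : EE d)
    (hc : ContinuousOn φ (Metric.closedBall 0 1))
    (hi : Integrable (GG β 0 φ x)) :
    Filter.Tendsto (fun ε => ∫ y, GG β ε φ x y) (nhdsWithin 0 (Set.Ioi 0))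
      (nhds (∫ y, GG β 0 φ x y)) := by
  refine tendsto_integral_filter_of_dominated_convergence (fun y => ‖GG β 0 φ x y‖)
    (Filter.Eventually.of_forall fun ε => GG_aesm β ε φ x hc) ?_ hi.norm ?_
  · filter_upwards [self_mem_nhdsWithin] with ε hε
    exact Filter.Eventually.of_forall fun y => GG_le β ε (le_of_lt hε) φ x y
  · refine Filter.Eventually.of_forall fun y => ?_
    by_cases hy : y = x
    · subst hy
      simp [GG, RR]
    · have hpos : 0 < ‖y - x‖ := norm_pos_iff.2 (sub_ne_zero.2 hy)
      refine tendsto_const_nhds.congr' ?_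
      filter_upwards [(eventually_lt_nhds hpos).filter_mono nhdsWithin_le_nhds] with ε hε
      have : y ∈ RR 0 x ↔ y ∈ RR ε x := by
        simp [RR, hε.le]
      by_cases h : y ∈ RR 0 x
      · rw [GG, GG, Set.indicator_of_mem h, Set.indicator_of_mem (this.1 h)]
      · rw [GG, GG, Set.indicator_of_notMem h, Set.indicator_of_notMem (fun h' => h (this.2 h'))]

lemma GG_pos {d : ℕ} (β : ℝ) (φ : EE d → ℝ) (x : EE d) (hx : ‖x‖ = 1)
    (hc : ContinuousOn φ (Metric.closedBall 0 1))
    (hi : Integrable (GG β 0 φ x))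
    (hnn : ∀ x ∈ closure (Metric.ball (0 : EE d) 1), 0 ≤ φ x)
    (hne : ∃ x ∈ closure (Metric.ball (0 : EE d) 1), φ x ≠ 0)
    (hbd : ∀ x ∈ Metric.sphere (0 : EE d) 1, φ x = 0) :
    0 < ∫ y, GG β 0 φ x y := by
  rw [clB] at hnn hne
  have h0 : 0 ≤ GG β 0 φ x := fun y =>
    Set.indicator_apply_nonneg fun h =>
      mul_nonneg (hnn y (by simpa using h.2.2)) (Real.rpow_nonneg (norm_nonneg _) _)
  rw [integral_pos_iff_support_of_nonneg h0 hi]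
  have hopen : IsOpen (Metric.ball (0 : EE d) 1 ∩ φ ⁻¹' Set.Ioi 0) :=
    (hc.mono Metric.ball_subset_closedBall).isOpen_inter_preimage Metric.isOpen_ball isOpen_Ioi
  have hnon : (Metric.ball (0 : EE d) 1 ∩ φ ⁻¹' Set.Ioi 0).Nonempty := by
    obtain ⟨u, hu, hu0⟩ := hne
    refine ⟨u, ?_, lt_of_le_of_ne (hnn u hu) hu0.symm⟩
    rw [mem_closedBall_zero_iff] at hu
    rw [mem_ball_zero_iff]
    refine lt_of_le_of_ne hu fun h => hu0 (hbd u (by simpa using h))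
  refine (hopen.measure_pos volume hnon).trans_le (measure_mono ?_)
  rintro y ⟨hy, hpos⟩
  rw [mem_ball_zero_iff] at hy
  have hin : (⟪y - x, x⟫ : ℝ) < 0 := by
    rw [inner_sub_left, real_inner_self_eq_norm_sq, hx]
    have := real_inner_le_norm y x
    rw [hx] at this
    linarith
  have hxy : 0 < ‖y - x‖ := by
    rw [norm_pos_iff, sub_ne_zero]
    rintro rfl
    linarith
  rw [Function.mem_support, GG, Set.indicator_of_mem (show y ∈ RR 0 x from ⟨hin, norm_nonneg _, hy.le⟩)]
  exact (mul_pos hpos (Real.rpow_pos_of_pos hxy _)).ne'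

/-- let `D = B(0,1) ⊂ ℝ^d`, `α ∈ (0,2)` and `β ∈ (0,α/2)`. For every pair
`φ₁, φ₂` of nonnegative, not identically zero, radially symmetric, `(α/2)`-Hölder
functions on `closure D` vanishing on `∂D`, there is `a > 0` with `φ₁ − aφ₂ ∈ H_β`. -/
theorem stmt_7 (d : ℕ) (hd : 2 ≤ d) (α β : ℝ) (hα : α ∈ Set.Ioo (0 : ℝ) 2)
    (hβ : β ∈ Set.Ioo (0 : ℝ) (α / 2))
    (φ₁ φ₂ : EuclideanSpace ℝ (Fin d) → ℝ)
    (h1nn : ∀ x ∈ closure (Metric.ball (0 : EuclideanSpace ℝ (Fin d)) 1), 0 ≤ φ₁ x)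
    (h2nn : ∀ x ∈ closure (Metric.ball (0 : EuclideanSpace ℝ (Fin d)) 1), 0 ≤ φ₂ x)
    (h1ne : ∃ x ∈ closure (Metric.ball (0 : EuclideanSpace ℝ (Fin d)) 1), φ₁ x ≠ 0)
    (h2ne : ∃ x ∈ closure (Metric.ball (0 : EuclideanSpace ℝ (Fin d)) 1), φ₂ x ≠ 0)
    (h1rad : ∀ u ∈ closure (Metric.ball (0 : EuclideanSpace ℝ (Fin d)) 1),
      ∀ v ∈ closure (Metric.ball (0 : EuclideanSpace ℝ (Fin d)) 1), ‖u‖ = ‖v‖ → φ₁ u = φ₁ v)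
    (h2rad : ∀ u ∈ closure (Metric.ball (0 : EuclideanSpace ℝ (Fin d)) 1),
      ∀ v ∈ closure (Metric.ball (0 : EuclideanSpace ℝ (Fin d)) 1), ‖u‖ = ‖v‖ → φ₂ u = φ₂ v)
    (h1hol : ∃ K : ℝ, ∀ u ∈ closure (Metric.ball (0 : EuclideanSpace ℝ (Fin d)) 1),
      ∀ v ∈ closure (Metric.ball (0 : EuclideanSpace ℝ (Fin d)) 1),
        |φ₁ u - φ₁ v| ≤ K * ‖u - v‖ ^ (α / 2))
    (h2hol : ∃ K : ℝ, ∀ u ∈ closure (Metric.ball (0 : EuclideanSpace ℝ (Fin d)) 1),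
      ∀ v ∈ closure (Metric.ball (0 : EuclideanSpace ℝ (Fin d)) 1),
        |φ₂ u - φ₂ v| ≤ K * ‖u - v‖ ^ (α / 2))
    (h1bd : ∀ x ∈ Metric.sphere (0 : EuclideanSpace ℝ (Fin d)) 1, φ₁ x = 0)
    (h2bd : ∀ x ∈ Metric.sphere (0 : EuclideanSpace ℝ (Fin d)) 1, φ₂ x = 0) :
    ∃ a : ℝ, 0 < a ∧ memHbeta d β (fun x => φ₁ x - a * φ₂ x) := by
  obtain ⟨K₁, hK₁⟩ := h1hol
  obtain ⟨K₂, hK₂⟩ := h2hol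
  have hγ : 0 < α / 2 := by linarith [hα.1]
  obtain ⟨x₀, hx₀⟩ : ∃ x₀ : EE d, ‖x₀‖ = 1 :=
    ⟨EuclideanSpace.single ⟨0, by omega⟩ 1, by simp⟩
  have hi1 := GG_int hd β (α / 2) K₁ hγ hβ.2 φ₁ x₀ hx₀ hK₁ h1bd
  have hi2 := GG_int hd β (α / 2) K₂ hγ hβ.2 φ₂ x₀ hx₀ hK₂ h2bd
  have hc1 := hol_cont (α / 2) K₁ hγ φ₁ hK₁
  have hc2 := hol_cont (α / 2) K₂ hγ φ₂ hK₂
  have hp1 := GG_pos β φ₁ x₀ hx₀ hc1 hi1 h1nn h1ne h1bd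
  have hp2 := GG_pos β φ₂ x₀ hx₀ hc2 hi2 h2nn h2ne h2bd
  set I₁ := ∫ y, GG β 0 φ₁ x₀ y with hI₁
  set I₂ := ∫ y, GG β 0 φ₂ x₀ y with hI₂
  refine ⟨I₁ / I₂, div_pos hp1 hp2, ?_⟩
  set a := I₁ / I₂ with ha
  have hlin : GG β 0 (fun x => φ₁ x - a * φ₂ x) x₀
      = fun y => GG β 0 φ₁ x₀ y - a * GG β 0 φ₂ x₀ y := by
    ext y
    by_cases h : y ∈ RR 0 x₀
    · simp only [GG, Set.indicator_of_mem h]; ring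
    · simp [GG, Set.indicator_of_notMem h]
  have hi : Integrable (GG β 0 (fun x => φ₁ x - a * φ₂ x) x₀) := by
    rw [hlin]; exact hi1.sub (hi2.const_mul a)
  have hz : ∫ y, GG β 0 (fun x => φ₁ x - a * φ₂ x) x₀ y = 0 := by
    rw [hlin, integral_sub hi1 (hi2.const_mul a), integral_const_mul, ← hI₁, ← hI₂, ha]
    field_simp
    ring
  have ht := GG_tendsto β (fun x => φ₁ x - a * φ₂ x) x₀
    (hc1.sub (continuousOn_const.mul hc2)) hi
  rw [hz] at ht
  intro δ hδ
  have hev := (Metric.tendsto_nhds.1 ht) δ hδ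
  obtain ⟨ε₀, hε₀, hsub⟩ := mem_nhdsGT_iff_exists_Ioo_subset.1 hev
  refine ⟨ε₀, hε₀, fun ε hε hlt x hx => ?_⟩
  have hx1 : ‖x‖ = 1 := by simpa using hx
  rw [Hbe_eq β ε _ x hx1 (fun z hz => by simp [h1bd z hz, h2bd z hz]),
    GG_rot β ε _ x x₀ hx1 hx₀
      (fun u hu v hv huv => by rw [h1rad u hu v hv huv, h2rad u hu v hv huv])]
  have := hsub ⟨hε, hlt⟩
  simp only [Set.mem_setOf_eq, dist_zero_right, Real.norm_eq_abs] at this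
  exact this.le
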